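/- Let H ∈ [1/6, 1/2), let (Ω,F,P) be a probability space, and let X¹, X² : ℝ → Ω → ℝ be two stochastic processes, independent of each other, such that each Xⁱ is a centered Gaussian process with covariance E[Xⁱ_s Xⁱ_t] = C_H(s,t) for all s,t ∈ ℝ. Let f ∈ C_b^∞(ℝ²), fix t ≥ 0, and let p,q ∈ ℕ with p+q odd. Assume either (H > 1/6 and p+q ≥ 3) or (H = 1/6 and p+q ≥ 5). Then E[(V_n^{p,q}(f,t))²] → 0 as n → ∞, i.e. V_n^{p,q}(f,t) converges to 0 in L²(Ω). -/

import Mathlib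

open MeasureTheory ProbabilityTheory Filter

noncomputable section

/-- Covariance function of the (two-sided) fractional Brownian motion with Hurst index `H`:
`C_H(t,s) = (|t|^{2H} + |s|^{2H} − |t−s|^{2H})/2`. -/
def covH (H t s : ℝ) : ℝ :=
  (|t| ^ (2 * H) + |s| ^ (2 * H) - |t - s| ^ (2 * H)) / 2

/-- `ρ_H(k) = (1/2)(|k+1|^{2H} + |k−1|^{2H} − 2|k|^{2H})`. -/
def rhoH (H : ℝ) (k : ℤ) : ℝ :=
  (|(k : ℝ) + 1| ^ (2 * H) + |(k : ℝ) - 1| ^ (2 * H) - 2 * |(k : ℝ)| ^ (2 * H)) / 2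

/-- `X` is a centered Gaussian process with covariance function `C` under `P`: every finite
linear combination of values of the process is a centered real Gaussian random variable with
the appropriate variance. -/
def IsCenteredGaussianProcess {Ω : Type*} [MeasurableSpace Ω] (P : Measure Ω)
    (X : ℝ → Ω → ℝ) (C : ℝ → ℝ → ℝ) : Prop :=
  (∀ t, Measurable (X t)) ∧
  ∀ (m : ℕ) (ts : Fin m → ℝ) (c : Fin m → ℝ),
    Measure.map (fun ω => ∑ i, c i * X (ts i) ω) P =
      gaussianReal 0 (Real.toNNReal (∑ i, ∑ j, c i * c j * C (ts i) (ts j)))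

/-- The σ-algebras generated by the two processes `X1` and `X2` are independent under `P`. -/
def IndepProcesses {Ω : Type*} [MeasurableSpace Ω] (P : Measure Ω)
    (X1 X2 : ℝ → Ω → ℝ) : Prop :=
  ProbabilityTheory.Indep
    (⨆ t : ℝ, MeasurableSpace.comap (X1 t) inferInstance)
    (⨆ t : ℝ, MeasurableSpace.comap (X2 t) inferInstance) P

/-- `g` is infinitely differentiable and bounded together with all its derivatives. -/
def CbSmooth {E : Type*} [NormedAddCommGroup E] [NormedSpace ℝ E] (g : E → ℝ) : Prop :=
  (∀ n : ℕ, ContDiff ℝ n g) ∧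
  ∀ k : ℕ, ∃ M : ℝ, ∀ x : E, ‖iteratedFDeriv ℝ k g x‖ ≤ M

/-- `f : ℝ² → ℝ` (in curried form) belongs to `C_b^∞(ℝ²)`. -/
def CbSmooth2 (f : ℝ → ℝ → ℝ) : Prop :=
  CbSmooth fun p : ℝ × ℝ => f p.1 p.2

/-- Partial derivative of `f : ℝ → ℝ → ℝ`, taken `k` times in the first variable and `l` times
in the second variable. -/
def pd (k l : ℕ) (f : ℝ → ℝ → ℝ) (x y : ℝ) : ℝ :=
  iteratedDeriv k (fun u => iteratedDeriv l (fun v => f u v) y) x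

/-- The dyadic point `j·2^{−n/2}`. -/
def dyadicPt (n j : ℕ) : ℝ := (j : ℝ) * (2 : ℝ) ^ (-(n : ℝ) / 2)

/-- The number of dyadic steps `⌊2^{n/2} t⌋`. -/
def nSteps (n : ℕ) (t : ℝ) : ℕ := Nat.floor ((2 : ℝ) ^ ((n : ℝ) / 2) * t)

variable {Ω : Type*}

/-- The increment `X_{(j+1)2^{−n/2}} − X_{j2^{−n/2}}` of the process `X`. -/
def Xincr (X : ℝ → Ω → ℝ) (n j : ℕ) (ω : Ω) : ℝ :=
  X (dyadicPt n (j + 1)) ω - X (dyadicPt n j) ω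

/-- The midpoint evaluation `Δ_{j,n} g(X¹,X²)`. -/
def Xmid (X1 X2 : ℝ → Ω → ℝ) (g : ℝ → ℝ → ℝ) (n j : ℕ) (ω : Ω) : ℝ :=
  g ((X1 (dyadicPt n (j + 1)) ω + X1 (dyadicPt n j) ω) / 2)
    ((X2 (dyadicPt n (j + 1)) ω + X2 (dyadicPt n j) ω) / 2)

/-- Polynomial solutions `g` of Stein's equation `x g(x) - g'(x) = x ^ (2 m + 1)`. -/
def steinPoly : ℕ → Polynomial ℝ
  | 0 => 1
  | m + 1 => Polynomial.X ^ (2 * m + 2) + Polynomial.C (2 * m + 2 : ℝ) * steinPoly m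

lemma X_mul_steinPoly_sub_derivative (m : ℕ) :
    Polynomial.X * steinPoly m - Polynomial.derivative (steinPoly m) =
      Polynomial.X ^ (2 * m + 1) := by
  induction m with
  | zero => simp [steinPoly]
  | succ m ih =>
    have h : Polynomial.derivative (steinPoly (m + 1)) =
        Polynomial.C (2 * m + 2 : ℝ) * Polynomial.X ^ (2 * m + 1) +
          Polynomial.C (2 * m + 2 : ℝ) * Polynomial.derivative (steinPoly m) := by
      rw [steinPoly, Polynomial.derivative_add, Polynomial.derivative_C_mul,
        Polynomial.derivative_X_pow]
      push_cast
      rfl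
    rw [h, ← ih, steinPoly]
    ring_nf

lemma hasDerivAt_gaussianPDFReal_zero_one (x : ℝ) :
    HasDerivAt (gaussianPDFReal 0 1) (-x * gaussianPDFReal 0 1 x) x := by
  rw [gaussianPDFReal_def]
  have h : HasDerivAt (fun y : ℝ => -(y - 0) ^ 2 / (2 * ((1 : NNReal) : ℝ))) (-x) x := by
    have h1 := (((hasDerivAt_id x).sub_const 0).pow 2).neg.div_const (2 * ((1 : NNReal) : ℝ))
    refine h1.congr_deriv ?_
    simp
    ring
  refine (h.exp.const_mul _).congr_deriv ?_
  ring

lemma integral_mul_eval_gaussianReal {g r : Polynomial ℝ}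
    (hgr : Polynomial.X * g - Polynomial.derivative g = r) {φ φ' : ℝ → ℝ}
    (hφ : ∀ x, HasDerivAt φ (φ' x) x)
    (h1 : Integrable (fun x => φ x * r.eval x) (gaussianReal 0 1))
    (h2 : Integrable (fun x => φ' x * g.eval x) (gaussianReal 0 1))
    (h3 : Integrable (fun x => φ x * g.eval x) (gaussianReal 0 1)) :
    ∫ x, φ x * r.eval x ∂(gaussianReal 0 1) = ∫ x, φ' x * g.eval x ∂(gaussianReal 0 1) := by
  have key : ∀ h : ℝ → ℝ, Integrable h (gaussianReal 0 1) →
      Integrable (fun x => gaussianPDFReal 0 1 x * h x) := by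
    intro h hh
    rw [gaussianReal_of_var_ne_zero _ one_ne_zero,
      integrable_withDensity_iff_integrable_smul' (measurable_gaussianPDF _ _)
        (ae_of_all _ fun _ ↦ gaussianPDF_lt_top)] at hh
    simpa using hh
  rw [integral_gaussianReal_eq_integral_smul one_ne_zero,
    integral_gaussianReal_eq_integral_smul one_ne_zero]
  have hr : ∀ x, r.eval x = x * g.eval x - (Polynomial.derivative g).eval x := by
    intro x; rw [← hgr]; simp
  have := integral_mul_deriv_eq_deriv_mul_of_integrable (u := φ) (u' := φ')
    (v := fun x => g.eval x * gaussianPDFReal 0 1 x)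
    (v' := fun x => - (r.eval x * gaussianPDFReal 0 1 x)) (fun x _ => hφ x)
    (fun x _ => ((g.hasDerivAt x).mul (hasDerivAt_gaussianPDFReal_zero_one x)).congr_deriv
      (by rw [hr]; ring))
    ((key _ h1).neg.congr (ae_of_all _ fun x => by simp; ring))
    ((key _ h2).congr (ae_of_all _ fun x => by simp; ring))
    ((key _ h3).congr (ae_of_all _ fun x => by simp; ring))
  have e1 : ∫ x, gaussianPDFReal 0 1 x • (φ x * r.eval x)
      = - ∫ x, φ x * - (r.eval x * gaussianPDFReal 0 1 x) := by
    rw [← integral_neg]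
    congr 1; ext x; simp; ring
  rw [e1, this, neg_neg]
  congr 1; ext x; simp; ring

/-- Gaussian integration by parts with respect to a standard Gaussian variable `U`, conditionally
on an independent random element `W`. -/
lemma integral_mul_eval_of_indepFun {Ω E : Type*} [MeasurableSpace Ω] [MeasurableSpace E]
    {P : Measure Ω} [IsProbabilityMeasure P] {U : Ω → ℝ} {W : Ω → E}
    (hU : Measurable U) (hW : Measurable W) (hlaw : P.map U = gaussianReal 0 1)
    (hind : IndepFun U W P) {g r : Polynomial ℝ}
    (hgr : Polynomial.X * g - Polynomial.derivative g = r) {φ φ' : ℝ → E → ℝ}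
    (hφm : Measurable (Function.uncurry φ)) (hφ'm : Measurable (Function.uncurry φ'))
    (hφ : ∀ w x, HasDerivAt (fun y => φ y w) (φ' x w) x)
    (h1 : Integrable (fun ω => φ (U ω) (W ω) * r.eval (U ω)) P)
    (h2 : Integrable (fun ω => φ' (U ω) (W ω) * g.eval (U ω)) P)
    (h3 : Integrable (fun ω => φ (U ω) (W ω) * g.eval (U ω)) P) :
    ∫ ω, φ (U ω) (W ω) * r.eval (U ω) ∂P = ∫ ω, φ' (U ω) (W ω) * g.eval (U ω) ∂P := by
  have hprod : P.map (fun ω => (W ω, U ω)) = (P.map W).prod (gaussianReal 0 1) := by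
    rw [← hlaw]
    exact (indepFun_iff_map_prod_eq_prod_map_map hW.aemeasurable hU.aemeasurable).1 hind.symm
  have := Measure.isProbabilityMeasure_map (μ := P) hW.aemeasurable
  have hm : ∀ (ψ : ℝ → E → ℝ) (s : Polynomial ℝ), Measurable (Function.uncurry ψ) →
      Measurable (fun z : E × ℝ => ψ z.2 z.1 * s.eval z.2) := fun ψ s hψ =>
    (hψ.comp measurable_swap).mul (s.continuous.measurable.comp measurable_snd)
  have tr : ∀ (ψ : ℝ → E → ℝ) (s : Polynomial ℝ), Measurable (Function.uncurry ψ) →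
      Integrable (fun ω => ψ (U ω) (W ω) * s.eval (U ω)) P →
      Integrable (fun z : E × ℝ => ψ z.2 z.1 * s.eval z.2) ((P.map W).prod (gaussianReal 0 1)) := by
    intro ψ s hψ hi
    rw [← hprod, integrable_map_measure (hm ψ s hψ).aestronglyMeasurable
      (hW.prodMk hU).aemeasurable]
    exact hi
  have trI : ∀ (ψ : ℝ → E → ℝ) (s : Polynomial ℝ), Measurable (Function.uncurry ψ) →
      Integrable (fun ω => ψ (U ω) (W ω) * s.eval (U ω)) P →
      ∫ ω, ψ (U ω) (W ω) * s.eval (U ω) ∂P =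
        ∫ w, ∫ u, ψ u w * s.eval u ∂(gaussianReal 0 1) ∂(P.map W) := by
    intro ψ s hψ hi
    rw [← integral_prod (fun z : E × ℝ => ψ z.2 z.1 * s.eval z.2) (tr ψ s hψ hi), ← hprod,
      integral_map (hW.prodMk hU).aemeasurable (hm ψ s hψ).aestronglyMeasurable]
  rw [trI φ r hφm h1, trI φ' g hφ'm h2]
  refine integral_congr_ae ?_
  filter_upwards [(tr φ r hφm h1).prod_right_ae, (tr φ' g hφ'm h2).prod_right_ae,
    (tr φ g hφm h3).prod_right_ae] with w k1 k2 k3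
  exact integral_mul_eval_gaussianReal hgr (hφ w) k1 k2 k3

lemma indepFun_sub_covariance_mul {Ω ι : Type*} [Fintype ι] [MeasurableSpace Ω] {P : Measure Ω}
    {U : Ω → ℝ} {Y : ι → Ω → ℝ} (h : HasGaussianLaw (fun ω => (U ω, fun i => Y i ω)) P)
    (hvar : cov[U, U; P] = 1) :
    IndepFun U (fun ω i => Y i ω - cov[U, Y i; P] * U ω) P := by
  have := h.isProbabilityMeasure
  let L : ℝ × (ι → ℝ) →L[ℝ] (Unit → ℝ) × (ι → ℝ) :=
    (ContinuousLinearMap.pi fun _ => ContinuousLinearMap.fst ℝ ℝ (ι → ℝ)).prod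
      (ContinuousLinearMap.pi fun i => (ContinuousLinearMap.proj i).comp
        (ContinuousLinearMap.snd ℝ ℝ (ι → ℝ)) -
          cov[U, Y i; P] • ContinuousLinearMap.fst ℝ ℝ (ι → ℝ))
  have h1 := h.map_fun L
  have h2 : HasGaussianLaw (fun ω => ((fun _ : Unit => U ω),
      fun i => Y i ω - cov[U, Y i; P] * U ω)) P := h1
  have h3 := HasGaussianLaw.indepFun_of_covariance_eval (X := fun _ : Unit => U)
    (Y := fun i ω => Y i ω - cov[U, Y i; P] * U ω) h2 ?_
  · exact h3.comp (φ := fun z : Unit → ℝ => z ()) (ψ := id) (measurable_pi_apply _) measurable_id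
  · intro _ i
    have hU := h.fst.memLp_two
    have hY := (h.snd.eval i).memLp_two
    rw [covariance_fun_sub_right hU hY (hU.const_mul _), covariance_const_mul_right, hvar]
    ring

/-- A random variable all of whose moments are finite. -/
def HasAllMoments {Ω : Type*} [MeasurableSpace Ω] (X : Ω → ℝ) (P : Measure Ω) : Prop :=
  ∀ r : NNReal, MemLp X r P

namespace HasAllMoments

variable {Ω : Type*} [MeasurableSpace Ω] {P : Measure Ω} {X Y : Ω → ℝ}

lemma integrable (hX : HasAllMoments X P) : Integrable X P := by
  simpa [memLp_one_iff_integrable] using hX 1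

lemma mul (hX : HasAllMoments X P) (hY : HasAllMoments Y P) :
    HasAllMoments (fun ω => X ω * Y ω) P := by
  intro r
  have : ENNReal.HolderTriple ((2 * r : NNReal) : ENNReal) ((2 * r : NNReal) : ENNReal) r := by
    constructor
    push_cast
    rw [ENNReal.mul_inv (by simp) (by simp), ← add_mul, ENNReal.inv_two_add_inv_two, one_mul]
  exact (hY (2 * r)).mul (hX (2 * r))

lemma add (hX : HasAllMoments X P) (hY : HasAllMoments Y P) :
    HasAllMoments (fun ω => X ω + Y ω) P := fun r => (hX r).add (hY r)

lemma of_bound [IsFiniteMeasure P] (hX : Measurable X) {C : ℝ} (h : ∀ ω, |X ω| ≤ C) :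
    HasAllMoments X P := fun _ =>
  MemLp.of_bound hX.aestronglyMeasurable C (ae_of_all _ h)

lemma const [IsFiniteMeasure P] (c : ℝ) : HasAllMoments (fun _ : Ω => c) P := fun _ => memLp_const c

lemma pow [IsFiniteMeasure P] (hX : HasAllMoments X P) (n : ℕ) :
    HasAllMoments (fun ω => X ω ^ n) P := by
  induction n with
  | zero => simpa using const (P := P) 1
  | succ n ih => simpa only [pow_succ] using ih.mul hX

lemma abs (hX : HasAllMoments X P) : HasAllMoments (fun ω => |X ω|) P := fun r => (hX r).abs

lemma eval [IsFiniteMeasure P] (hX : HasAllMoments X P) (Q : Polynomial ℝ) :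
    HasAllMoments (fun ω => Q.eval (X ω)) P := by
  induction Q using Polynomial.induction_on' with
  | add p q hp hq => simpa using hp.add hq
  | monomial n a => simpa using (const (P := P) a).mul (hX.pow n)

end HasAllMoments

lemma ProbabilityTheory.HasGaussianLaw.hasAllMoments {Ω : Type*} [MeasurableSpace Ω]
    {P : Measure Ω} {X : Ω → ℝ} (h : HasGaussianLaw X P) : HasAllMoments X P :=
  fun _ => h.memLp ENNReal.coe_ne_top

/-- Gaussian integration by parts: a standard Gaussian `U` is removed from `E[F(A) G(B) Q(V) r(U)]`
at the cost of differentiating the other factors. -/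
lemma integral_mul_eval_hasGaussianLaw {Ω : Type*} [MeasurableSpace Ω] {P : Measure Ω}
    {A B U V : Ω → ℝ} (hA : Measurable A) (hB : Measurable B) (hU : Measurable U)
    (hV : Measurable V) (hG : HasGaussianLaw (fun ω => (U ω, fun i => ![A, B, V] i ω)) P)
    (hlaw : P.map U = gaussianReal 0 1) {g r : Polynomial ℝ}
    (hgr : Polynomial.X * g - Polynomial.derivative g = r) (Q : Polynomial ℝ)
    {F F' G G' : ℝ → ℝ} {M : ℝ} (hF : ∀ x, HasDerivAt F (F' x) x)
    (hG' : ∀ x, HasDerivAt G (G' x) x) (bF : ∀ x, |F x| ≤ M) (bF' : ∀ x, |F' x| ≤ M)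
    (bG : ∀ x, |G x| ≤ M) (bG' : ∀ x, |G' x| ≤ M) :
    ∫ ω, F (A ω) * G (B ω) * Q.eval (V ω) * r.eval (U ω) ∂P =
      cov[U, A; P] * ∫ ω, F' (A ω) * G (B ω) * Q.eval (V ω) * g.eval (U ω) ∂P +
      cov[U, B; P] * ∫ ω, F (A ω) * G' (B ω) * Q.eval (V ω) * g.eval (U ω) ∂P +
      cov[U, V; P] * ∫ ω, F (A ω) * G (B ω) * (Polynomial.derivative Q).eval (V ω) *
        g.eval (U ω) ∂P := by
  have := hG.isProbabilityMeasure
  have hvar : cov[U, U; P] = 1 := by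
    rw [covariance_self hU.aemeasurable]
    have : Var[id; P.map U] = 1 := by rw [hlaw, variance_id_gaussianReal]; simp
    rwa [variance_map aemeasurable_id hU.aemeasurable] at this
  have hind := indepFun_sub_covariance_mul hG hvar
  have mF : Measurable F := (continuous_iff_continuousAt.2 fun x => (hF x).continuousAt).measurable
  have mG : Measurable G := (continuous_iff_continuousAt.2 fun x => (hG' x).continuousAt).measurable
  have mF' : Measurable F' := by
    rw [show F' = deriv F from funext fun x => (hF x).deriv.symm]; exact measurable_deriv F
  have mG' : Measurable G' := by
    rw [show G' = deriv G from funext fun x => (hG' x).deriv.symm]; exact measurable_deriv G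
  have aU := hG.fst.hasAllMoments
  have aV : HasAllMoments V P := (hG.snd.eval 2).hasAllMoments
  set a := cov[U, A; P] with ha
  set b := cov[U, B; P] with hb
  set c := cov[U, V; P] with hc
  have hInteg : ∀ (F G : ℝ → ℝ) (Q s : Polynomial ℝ), Measurable F → Measurable G →
      (∀ x, |F x| ≤ M) → (∀ x, |G x| ≤ M) →
      Integrable (fun ω => F (A ω) * G (B ω) * Q.eval (V ω) * s.eval (U ω)) P := by
    intro F G Q s mF mG bF bG
    exact ((((HasAllMoments.of_bound (mF.comp hA) fun ω => bF _).mul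
      (HasAllMoments.of_bound (mG.comp hB) fun ω => bG _)).mul (aV.eval Q)).mul
        (aU.eval s)).integrable
  have mQ : ∀ Q : Polynomial ℝ, Measurable (fun x => Q.eval x) := fun Q => Q.continuous.measurable
  have hW : Measurable (fun ω (i : Fin 3) => ![A, B, V] i ω - cov[U, ![A, B, V] i; P] * U ω) := by
    refine measurable_pi_lambda _ fun i => ?_
    fin_cases i
    · exact hA.sub (hU.const_mul _)
    · exact hB.sub (hU.const_mul _)
    · exact hV.sub (hU.const_mul _)
  have key := integral_mul_eval_of_indepFun hU hW hlaw hind hgr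
    (φ := fun x w => F (w 0 + a * x) * G (w 1 + b * x) * Q.eval (w 2 + c * x))
    (φ' := fun x w => (F' (w 0 + a * x) * a * G (w 1 + b * x) +
      F (w 0 + a * x) * (G' (w 1 + b * x) * b)) * Q.eval (w 2 + c * x) +
      F (w 0 + a * x) * G (w 1 + b * x) *
        ((Polynomial.derivative Q).eval (w 2 + c * x) * c))
    (by
      have := mQ Q
      unfold Function.uncurry; fun_prop)
    (by
      have := mQ Q
      have := mQ (Polynomial.derivative Q)
      unfold Function.uncurry; fun_prop)
    (by
      intro w x
      have hl : ∀ i (k : ℝ), HasDerivAt (fun y => w i + k * y) k x := fun i k => by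
        simpa using ((hasDerivAt_id x).const_mul k).const_add (w i)
      exact (((hF _).comp x (hl 0 a)).mul ((hG' _).comp x (hl 1 b))).mul
        ((Q.hasDerivAt _).comp x (hl 2 c)))
  have e0 : ∀ ω, ![A, B, V] 0 ω - cov[U, ![A, B, V] 0; P] * U ω + a * U ω = A ω :=
    fun ω => by simp [a]
  have e1 : ∀ ω, ![A, B, V] 1 ω - cov[U, ![A, B, V] 1; P] * U ω + b * U ω = B ω :=
    fun ω => by simp [b]
  have e2 : ∀ ω, ![A, B, V] 2 ω - cov[U, ![A, B, V] 2; P] * U ω + c * U ω = V ω :=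
    fun ω => by simp [c]
  simp only [e0, e1, e2] at key
  have i1 := hInteg F' G Q g mF' mG bF' bG
  have i2 := hInteg F G' Q g mF mG' bF bG'
  have i3 := hInteg F G (Polynomial.derivative Q) g mF mG bF bG
  have esplit : ∀ ω, ((F' (A ω) * a * G (B ω) + F (A ω) * (G' (B ω) * b)) * Q.eval (V ω) +
      F (A ω) * G (B ω) * ((Polynomial.derivative Q).eval (V ω) * c)) * g.eval (U ω) =
      a * (F' (A ω) * G (B ω) * Q.eval (V ω) * g.eval (U ω)) +
      b * (F (A ω) * G' (B ω) * Q.eval (V ω) * g.eval (U ω)) +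
      c * (F (A ω) * G (B ω) * (Polynomial.derivative Q).eval (V ω) * g.eval (U ω)) := by
    intro ω; ring
  simp only [esplit] at key
  have i12 : Integrable (fun ω => a * (F' (A ω) * G (B ω) * Q.eval (V ω) * g.eval (U ω)) +
      b * (F (A ω) * G' (B ω) * Q.eval (V ω) * g.eval (U ω))) P :=
    (i1.const_mul a).add (i2.const_mul b)
  rw [key (hInteg F G Q r mF mG bF bG) (i12.add (i3.const_mul c)) (hInteg F G Q g mF mG bF bG),
    integral_add i12 (i3.const_mul c), integral_add (i1.const_mul a) (i2.const_mul b),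
    integral_const_mul, integral_const_mul, integral_const_mul]

lemma abs_integral_mul_eval_le {Ω : Type*} [MeasurableSpace Ω] {P : Measure Ω}
    [IsProbabilityMeasure P] {U V : Ω → ℝ} (hU : Measurable U) (hV : Measurable V)
    (lU : P.map U = gaussianReal 0 1) (lV : P.map V = gaussianReal 0 1) {f g : Ω → ℝ} {M : ℝ}
    (bf : ∀ ω, |f ω| ≤ M) (bg : ∀ ω, |g ω| ≤ M) (Q s : Polynomial ℝ) :
    |∫ ω, f ω * g ω * Q.eval (V ω) * s.eval (U ω) ∂P| ≤
      M ^ 2 * (∫ x, Q.eval x ^ 2 ∂(gaussianReal 0 1) + ∫ x, s.eval x ^ 2 ∂(gaussianReal 0 1)) := by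
  have tr : ∀ (W : Ω → ℝ) (R : Polynomial ℝ), Measurable W → P.map W = gaussianReal 0 1 →
      Integrable (fun ω => R.eval (W ω) ^ 2) P ∧
      ∫ ω, R.eval (W ω) ^ 2 ∂P = ∫ x, R.eval x ^ 2 ∂(gaussianReal 0 1) := by
    intro W R hW lW
    have hG : HasGaussianLaw W P := ⟨by rw [lW]; infer_instance⟩
    refine ⟨((hG.hasAllMoments.eval R).pow 2).integrable, ?_⟩
    rw [← lW, integral_map hW.aemeasurable]
    exact (R.continuous.pow 2).measurable.aestronglyMeasurable
  obtain ⟨iQ, eQ⟩ := tr V Q hV lV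
  obtain ⟨is, es⟩ := tr U s hU lU
  rw [← eQ, ← es, ← integral_add iQ is, ← integral_const_mul, ← Real.norm_eq_abs]
  refine norm_integral_le_of_norm_le ((iQ.add is).const_mul _) (ae_of_all _ fun ω => ?_)
  rw [Real.norm_eq_abs, mul_assoc, abs_mul]
  have hM : 0 ≤ M := (abs_nonneg _).trans (bf ω)
  have h1 : |f ω * g ω| ≤ M ^ 2 := by
    rw [abs_mul, sq]; exact mul_le_mul (bf ω) (bg ω) (abs_nonneg _) hM
  refine mul_le_mul h1 ?_ (abs_nonneg _) (sq_nonneg M)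
  rw [abs_le]
  constructor <;> nlinarith [sq_nonneg (Q.eval (V ω) + s.eval (U ω)),
    sq_nonneg (Q.eval (V ω) - s.eval (U ω))]

/-- Decoupling estimate for odd powers of two standard Gaussian variables `U`, `V` weighted by
smooth functions of jointly Gaussian variables `A`, `B`. -/
lemma exists_abs_integral_mul_pow_le {Ω : Type*} [MeasurableSpace Ω] (P : Measure Ω)
    [IsProbabilityMeasure P] {p : ℕ} (hp : Odd p) :
    ∃ C : ℝ, 0 ≤ C ∧ ∀ (A B U V : Ω → ℝ), Measurable A → Measurable B → Measurable U →
      Measurable V → HasGaussianLaw (fun ω i => ![A, B, U, V] i ω) P →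
      P.map U = gaussianReal 0 1 → P.map V = gaussianReal 0 1 →
      ∀ (F F₁ F₂ G G₁ G₂ : ℝ → ℝ) (M : ℝ), (∀ x, HasDerivAt F (F₁ x) x) →
      (∀ x, HasDerivAt F₁ (F₂ x) x) → (∀ x, HasDerivAt G (G₁ x) x) →
      (∀ x, HasDerivAt G₁ (G₂ x) x) → (∀ x, |F x| ≤ M) → (∀ x, |F₁ x| ≤ M) →
      (∀ x, |F₂ x| ≤ M) → (∀ x, |G x| ≤ M) → (∀ x, |G₁ x| ≤ M) → (∀ x, |G₂ x| ≤ M) →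
      |∫ ω, F (A ω) * G (B ω) * V ω ^ p * U ω ^ p ∂P| ≤
        C * M ^ 2 * (|cov[U, V; P]| * (1 + |cov[U, A; P]| + |cov[U, B; P]|) +
          (|cov[U, A; P]| + |cov[U, B; P]|) * (|cov[V, A; P]| + |cov[V, B; P]|)) := by
  obtain ⟨m, rfl⟩ := hp
  let μ : Polynomial ℝ → ℝ := fun Q => ∫ x, Q.eval x ^ 2 ∂(gaussianReal 0 1)
  have hμ : ∀ Q, 0 ≤ μ Q := fun Q => integral_nonneg fun x => sq_nonneg _
  let g := steinPoly m
  let r : Polynomial ℝ := Polynomial.X ^ (2 * m + 1)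
  refine ⟨2 * μ g + μ (Polynomial.derivative g) + μ (Polynomial.derivative r), by
    linarith [hμ g, hμ (Polynomial.derivative g), hμ (Polynomial.derivative r)], ?_⟩
  intro A B U V hA hB hU hV hG lU lV F F₁ F₂ G G₁ G₂ M dF dF₁ dG dG₁ bF bF₁ bF₂ bG bG₁ bG₂
  have hgr : Polynomial.X * g - Polynomial.derivative g = r := X_mul_steinPoly_sub_derivative m
  have hGU : HasGaussianLaw (fun ω => (U ω, fun i => ![A, B, V] i ω)) P := by
    let L : (Fin 4 → ℝ) →L[ℝ] ℝ × (Fin 3 → ℝ) :=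
      (ContinuousLinearMap.proj 2).prod (ContinuousLinearMap.pi fun i =>
        ContinuousLinearMap.proj (![0, 1, 3] i))
    have hL : (fun ω => (U ω, fun i => ![A, B, V] i ω)) =
        fun ω => L (fun i => ![A, B, U, V] i ω) := by
      funext ω
      refine Prod.ext rfl (funext fun i => ?_)
      fin_cases i <;> rfl
    rw [hL]
    exact hG.map_fun L
  have hGV : HasGaussianLaw (fun ω => (V ω, fun i => ![A, B, U] i ω)) P := by
    let L : (Fin 4 → ℝ) →L[ℝ] ℝ × (Fin 3 → ℝ) :=
      (ContinuousLinearMap.proj 3).prod (ContinuousLinearMap.pi fun i =>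
        ContinuousLinearMap.proj (![0, 1, 2] i))
    have hL : (fun ω => (V ω, fun i => ![A, B, U] i ω)) =
        fun ω => L (fun i => ![A, B, U, V] i ω) := by
      funext ω
      refine Prod.ext rfl (funext fun i => ?_)
      fin_cases i <;> rfl
    rw [hL]
    exact hG.map_fun L
  have step := integral_mul_eval_hasGaussianLaw hA hB hU hV hGU lU hgr r dF dG bF bF₁ bG bG₁
  have hr : ∀ x, r.eval x = x ^ (2 * m + 1) := fun x => by simp [r]
  have step₁ := integral_mul_eval_hasGaussianLaw hA hB hV hU hGV lV hgr g dF₁ dG bF₁ bF₂ bG bG₁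
  have step₂ := integral_mul_eval_hasGaussianLaw hA hB hV hU hGV lV hgr g dF dG₁ bF bF₁ bG₁ bG₂
  have comm : ∀ (F G : ℝ → ℝ), ∫ ω, F (A ω) * G (B ω) * r.eval (V ω) * g.eval (U ω) ∂P =
      ∫ ω, F (A ω) * G (B ω) * g.eval (U ω) * r.eval (V ω) ∂P := fun F G => by
    congr 1; ext ω; ring
  have b₁ := abs_integral_mul_eval_le hV hU lV lU (fun ω => bF₂ (A ω)) (fun ω => bG (B ω)) g g
  have b₂ := abs_integral_mul_eval_le hV hU lV lU (fun ω => bF₁ (A ω)) (fun ω => bG₁ (B ω)) g g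
  have b₃ := abs_integral_mul_eval_le hV hU lV lU (fun ω => bF (A ω)) (fun ω => bG₂ (B ω)) g g
  have b₄ := abs_integral_mul_eval_le hV hU lV lU (fun ω => bF₁ (A ω)) (fun ω => bG (B ω))
    (Polynomial.derivative g) g
  have b₅ := abs_integral_mul_eval_le hV hU lV lU (fun ω => bF (A ω)) (fun ω => bG₁ (B ω))
    (Polynomial.derivative g) g
  have b₆ := abs_integral_mul_eval_le hU hV lU lV (fun ω => bF (A ω)) (fun ω => bG (B ω))
    (Polynomial.derivative r) g
  simp only [← hr]
  rw [step, comm F₁ G, comm F G₁, step₁, step₂, covariance_comm V U]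
  change _ ≤ M ^ 2 * (μ _ + μ _) at b₁ b₂ b₃ b₄ b₅ b₆
  have hM := sq_nonneg M
  have h₁ := hμ g
  have h₂ := hμ (Polynomial.derivative g)
  have h₃ := hμ (Polynomial.derivative r)
  set D := (2 * μ g + μ (Polynomial.derivative g) + μ (Polynomial.derivative r)) * M ^ 2 with hD
  have d₀ : M ^ 2 * (μ g + μ g) ≤ D := by rw [hD]; nlinarith
  have d₁ : M ^ 2 * (μ (Polynomial.derivative g) + μ g) ≤ D := by rw [hD]; nlinarith
  have d₂ : M ^ 2 * (μ (Polynomial.derivative r) + μ g) ≤ D := by rw [hD]; nlinarith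
  have three : ∀ {x y z a b c : ℝ}, |x| ≤ D → |y| ≤ D → |z| ≤ D →
      |a * x + b * y + c * z| ≤ (|a| + |b| + |c|) * D := by
    intro x y z a b c hx hy hz
    calc |a * x + b * y + c * z| ≤ |a * x| + |b * y| + |c * z| := abs_add_three _ _ _
      _ = |a| * |x| + |b| * |y| + |c| * |z| := by simp only [abs_mul]
      _ ≤ |a| * D + |b| * D + |c| * D := by gcongr
      _ = _ := by ring
  have t₁ := three (a := cov[V, A; P]) (b := cov[V, B; P]) (c := cov[U, V; P])
    (b₁.trans d₀) (b₂.trans d₀) (b₄.trans d₁)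
  have t₂ := three (a := cov[V, A; P]) (b := cov[V, B; P]) (c := cov[U, V; P])
    (b₂.trans d₀) (b₃.trans d₀) (b₅.trans d₁)
  refine (abs_add_three _ _ _).trans ?_
  simp only [abs_mul (cov[U, A; P]), abs_mul (cov[U, B; P]), abs_mul (cov[U, V; P])]
  have k₁ := mul_le_mul_of_nonneg_left t₁ (abs_nonneg cov[U, A; P])
  have k₂ := mul_le_mul_of_nonneg_left t₂ (abs_nonneg cov[U, B; P])
  have k₃ := mul_le_mul_of_nonneg_left (b₆.trans d₂) (abs_nonneg cov[U, V; P])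
  linarith

/-- Covariance of the `j`-th unit increment with the value at time `m`. -/
def incrCov (H : ℝ) (j m : ℕ) : ℝ := covH H (j + 1) m - covH H j m

/-- Covariance of the `j`-th unit increment with the `k`-th midpoint. -/
def incrMidCov (H : ℝ) (j k : ℕ) : ℝ := (incrCov H j k + incrCov H j (k + 1)) / 2

/-- Covariance of the `j`-th and `k`-th unit increments. -/
def incrIncrCov (H : ℝ) (j k : ℕ) : ℝ := incrCov H j (k + 1) - incrCov H j k

lemma incrCov_eq (H : ℝ) (j m : ℕ) :
    incrCov H j m = ((|(j : ℝ) + 1| ^ (2 * H) - |(j : ℝ)| ^ (2 * H)) -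
      (|(j : ℝ) + 1 - m| ^ (2 * H) - |(j : ℝ) - m| ^ (2 * H))) / 2 := by
  unfold incrCov covH; ring

lemma abs_abs_rpow_sub_le {κ : ℝ} (h0 : 0 < κ) (h1 : κ ≤ 1) (x y : ℝ) :
    |(|x| ^ κ - |y| ^ κ)| ≤ |x - y| ^ κ := by
  have key : ∀ x y : ℝ, |x| ^ κ ≤ |y| ^ κ + |x - y| ^ κ := fun x y =>
    calc |x| ^ κ ≤ (|y| + |x - y|) ^ κ := by
          gcongr
          calc |x| = |y + (x - y)| := by ring_nf
            _ ≤ _ := abs_add_le _ _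
      _ ≤ _ := Real.rpow_add_le_add_rpow (abs_nonneg _) (abs_nonneg _) h0.le h1
  rw [abs_le]
  have := key x y
  have := key y x
  rw [abs_sub_comm y x] at this
  constructor <;> linarith

lemma abs_incrCov_le {H : ℝ} (h0 : 0 < H) (h1 : H < 1 / 2) (j m : ℕ) : |incrCov H j m| ≤ 1 := by
  have h := fun x : ℝ => abs_abs_rpow_sub_le (κ := 2 * H) (by linarith) (by linarith) (x + 1) x
  simp only [add_sub_cancel_left, abs_one, Real.one_rpow] at h
  have a := h j
  have b := h (j - m)
  rw [sub_add_eq_add_sub] at b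
  rw [incrCov_eq, abs_div, abs_two, div_le_one two_pos]
  exact (abs_sub _ _).trans (by linarith)

lemma abs_incrMidCov_le {H : ℝ} (h0 : 0 < H) (h1 : H < 1 / 2) (j k : ℕ) :
    |incrMidCov H j k| ≤ 1 := by
  rw [incrMidCov, abs_div, abs_two, div_le_one two_pos]
  exact (abs_add_le _ _).trans
    (by linarith [abs_incrCov_le h0 h1 j k, abs_incrCov_le h0 h1 j (k + 1)])

lemma sum_abs_abs_rpow_sub_le {κ : ℝ} (h0 : 0 < κ) {m N : ℕ} (hm : m ≤ N) :
    ∑ j ∈ Finset.range N, |(|(j : ℝ) + 1 - m| ^ κ - |(j : ℝ) - m| ^ κ)| ≤ 2 * (N : ℝ) ^ κ := by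
  let ψ : ℕ → ℝ := fun j => if m ≤ j then |(j : ℝ) - m| ^ κ else -|(j : ℝ) - m| ^ κ
  have h : ∀ j : ℕ, |(|(j : ℝ) + 1 - m| ^ κ - |(j : ℝ) - m| ^ κ)| = ψ (j + 1) - ψ j := by
    intro j
    simp only [ψ]
    push_cast
    by_cases hj : m ≤ j
    · have hj' : (m : ℝ) ≤ j := by exact_mod_cast hj
      rw [if_pos (by omega), if_pos hj, abs_of_nonneg]
      rw [sub_nonneg, abs_of_nonneg (by linarith), abs_of_nonneg (by linarith)]
      exact Real.rpow_le_rpow (by linarith) (by linarith) h0.le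
    · have hj' : (j : ℝ) + 1 ≤ m := by exact_mod_cast Nat.lt_of_not_le hj
      rw [if_neg hj, abs_of_nonpos]
      · split_ifs with hh
        · have : (m : ℝ) = j + 1 := by
            have : m = j + 1 := by omega
            exact_mod_cast this
          rw [this]
          simp [h0.ne']
        · ring
      · rw [sub_nonpos, abs_of_nonpos (by linarith), abs_of_nonpos (by linarith)]
        exact Real.rpow_le_rpow (by linarith) (by linarith) h0.le
  simp only [h]
  rw [Finset.sum_range_sub]
  have hm' : (m : ℝ) ≤ N := by exact_mod_cast hm
  have h2 : ψ N ≤ (N : ℝ) ^ κ := by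
    simp only [ψ, if_pos hm]
    rw [abs_of_nonneg (by linarith)]
    exact Real.rpow_le_rpow (by linarith) (by linarith [(Nat.cast_nonneg m : (0 : ℝ) ≤ m)]) h0.le
  have h3 : -ψ 0 ≤ (N : ℝ) ^ κ := by
    simp only [ψ]
    have : |((0 : ℕ) : ℝ) - m| ^ κ ≤ (N : ℝ) ^ κ := by
      simp only [CharP.cast_eq_zero, zero_sub, abs_neg, Nat.abs_cast]
      exact Real.rpow_le_rpow (Nat.cast_nonneg _) hm' h0.le
    have h4 : 0 ≤ |((0 : ℕ) : ℝ) - m| ^ κ := Real.rpow_nonneg (abs_nonneg _) _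
    split_ifs <;> linarith
  linarith

lemma sum_abs_rpow_succ_sub {κ : ℝ} (h0 : 0 < κ) (N : ℕ) :
    ∑ j ∈ Finset.range N, |(|(j : ℝ) + 1| ^ κ - |(j : ℝ)| ^ κ)| = (N : ℝ) ^ κ := by
  have h : ∀ j : ℕ, |(|(j : ℝ) + 1| ^ κ - |(j : ℝ)| ^ κ)| =
      ((j + 1 : ℕ) : ℝ) ^ κ - (j : ℝ) ^ κ := by
    intro j
    have : (0 : ℝ) ≤ j := Nat.cast_nonneg j
    push_cast
    rw [abs_of_nonneg this, abs_of_nonneg (by linarith : (0 : ℝ) ≤ j + 1), abs_of_nonneg]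
    exact sub_nonneg.2 (Real.rpow_le_rpow this (by linarith) h0.le)
  simp only [h]
  rw [Finset.sum_range_sub (fun j : ℕ => (j : ℝ) ^ κ)]
  simp [h0.ne']

lemma sum_abs_incrCov_le {H : ℝ} (h0 : 0 < H) {m N : ℕ} (hm : m ≤ N) :
    ∑ j ∈ Finset.range N, |incrCov H j m| ≤ 2 * (N : ℝ) ^ (2 * H) := by
  have hκ : 0 < 2 * H := by linarith
  have h : ∀ j ∈ Finset.range N, |incrCov H j m| ≤
      (|(|(j : ℝ) + 1| ^ (2 * H) - |(j : ℝ)| ^ (2 * H))| +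
        |(|(j : ℝ) + 1 - m| ^ (2 * H) - |(j : ℝ) - m| ^ (2 * H))|) / 2 := by
    intro j _
    rw [incrCov_eq, abs_div, abs_two]
    gcongr
    exact abs_sub _ _
  refine (Finset.sum_le_sum h).trans ?_
  rw [← Finset.sum_div, Finset.sum_add_distrib, sum_abs_rpow_succ_sub hκ]
  have := sum_abs_abs_rpow_sub_le hκ hm
  have : (0 : ℝ) ≤ (N : ℝ) ^ (2 * H) := by positivity
  linarith

lemma sum_abs_incrMidCov_le {H : ℝ} (h0 : 0 < H) {k N : ℕ} (hk : k < N) :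
    ∑ j ∈ Finset.range N, |incrMidCov H j k| ≤ 2 * (N : ℝ) ^ (2 * H) := by
  have h : ∀ j ∈ Finset.range N, |incrMidCov H j k| ≤
      (|incrCov H j k| + |incrCov H j (k + 1)|) / 2 := by
    intro j _
    rw [incrMidCov, abs_div, abs_two]
    gcongr
    exact abs_add_le _ _
  refine (Finset.sum_le_sum h).trans ?_
  rw [← Finset.sum_div, Finset.sum_add_distrib]
  linarith [sum_abs_incrCov_le h0 hk.le, sum_abs_incrCov_le h0 (Nat.succ_le_of_lt hk)]

lemma sum_abs_incrMidCov_self_le {H : ℝ} (h0 : 0 < H) (N : ℕ) :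
    ∑ j ∈ Finset.range N, |incrMidCov H j j| ≤ (N : ℝ) ^ (2 * H) := by
  have hκ : 0 < 2 * H := by linarith
  have h : ∀ j : ℕ, |incrMidCov H j j| =
      |(|(j : ℝ) + 1| ^ (2 * H) - |(j : ℝ)| ^ (2 * H))| / 2 := by
    intro j
    have : incrMidCov H j j = (|(j : ℝ) + 1| ^ (2 * H) - |(j : ℝ)| ^ (2 * H)) / 2 := by
      rw [incrMidCov, incrCov_eq, incrCov_eq]
      push_cast
      simp only [add_sub_cancel_left, sub_self, abs_zero, sub_add_cancel_left, abs_neg]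
      ring
    rw [this, abs_div, abs_two]
  simp only [h]
  rw [← Finset.sum_div, sum_abs_rpow_succ_sub hκ]
  have : (0 : ℝ) ≤ (N : ℝ) ^ (2 * H) := by positivity
  linarith

lemma incrIncrCov_eq (H : ℝ) (j k : ℕ) : incrIncrCov H j k =
    (|(j : ℝ) - k + 1| ^ (2 * H) + |(j : ℝ) - k - 1| ^ (2 * H) -
      2 * |(j : ℝ) - k| ^ (2 * H)) / 2 := by
  rw [incrIncrCov, incrCov_eq, incrCov_eq]
  push_cast
  rw [show (j : ℝ) + 1 - (k + 1) = j - k by ring, show (j : ℝ) - (k + 1) = j - k - 1 by ring,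
    show (j : ℝ) + 1 - k = j - k + 1 by ring]
  ring

lemma incrIncrCov_self {H : ℝ} (h0 : 0 < H) (j : ℕ) : incrIncrCov H j j = 1 := by
  rw [incrIncrCov_eq]
  simp [h0.ne']

lemma incrIncrCov_nonpos {H : ℝ} (h0 : 0 < H) (h1 : H < 1 / 2) {j k : ℕ} (hjk : j ≠ k) :
    incrIncrCov H j k ≤ 0 := by
  have conc : ∀ x : ℝ, 1 ≤ x → (x + 1) ^ (2 * H) + (x - 1) ^ (2 * H) ≤ 2 * x ^ (2 * H) := by
    intro x hx
    have := (Real.concaveOn_rpow (p := 2 * H) (by linarith) (by linarith)).2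
      (show x + 1 ∈ Set.Ici 0 by simp; linarith) (show x - 1 ∈ Set.Ici 0 by simp; linarith)
      (show (0 : ℝ) ≤ 1 / 2 by norm_num) (show (0 : ℝ) ≤ 1 / 2 by norm_num) (by norm_num)
    simp only [smul_eq_mul] at this
    rw [show (1 / 2 * (x + 1) + 1 / 2 * (x - 1) : ℝ) = x by ring] at this
    linarith
  rw [incrIncrCov_eq]
  rcases lt_or_gt_of_ne hjk with h | h
  · have h' : (j : ℝ) + 1 ≤ k := by exact_mod_cast h
    have := conc (k - j) (by linarith)
    rw [abs_of_nonpos (by linarith), abs_of_nonpos (by linarith), abs_of_nonpos (by linarith),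
      show -((j : ℝ) - k + 1) = k - j - 1 by ring, show -((j : ℝ) - k - 1) = k - j + 1 by ring,
      show -((j : ℝ) - k) = k - j by ring]
    linarith
  · have h' : (k : ℝ) + 1 ≤ j := by exact_mod_cast h
    have := conc (j - k) (by linarith)
    rw [abs_of_nonneg (by linarith), abs_of_nonneg (by linarith), abs_of_nonneg (by linarith)]
    linarith

lemma sum_abs_incrIncrCov_le {H : ℝ} (h0 : 0 < H) (h1 : H < 1 / 2) (j N : ℕ) :
    ∑ k ∈ Finset.range N, |incrIncrCov H j k| ≤ 4 := by
  have h : ∀ k ∈ Finset.range N, |incrIncrCov H j k| ≤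
      (if j = k then 2 else 0) - incrIncrCov H j k := by
    intro k _
    split_ifs with hjk
    · subst hjk; rw [incrIncrCov_self h0]; norm_num
    · rw [abs_of_nonpos (incrIncrCov_nonpos h0 h1 hjk)]; linarith
  refine (Finset.sum_le_sum h).trans ?_
  rw [Finset.sum_sub_distrib, Finset.sum_ite_eq]
  simp only [incrIncrCov]
  rw [Finset.sum_range_sub (fun k => incrCov H j k)]
  have h2 := (abs_le.1 (abs_incrCov_le h0 h1 j N)).1
  have h3 := (abs_le.1 (abs_incrCov_le h0 h1 j 0)).2
  split_ifs <;> linarith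

/-- The total size of the covariance terms produced by two integrations by parts. -/
lemma sum_sum_covariance_le {H s : ℝ} (h0 : 0 < H) (h1 : H < 1 / 2) (hs1 : s ≤ 1)
    (N : ℕ) :
    ∑ j ∈ Finset.range N, ∑ k ∈ Finset.range N,
      (|incrIncrCov H j k| * (1 + s * (|incrMidCov H j j| + |incrMidCov H j k|)) +
        s ^ 2 * ((|incrMidCov H j j| + |incrMidCov H j k|) *
          (|incrMidCov H k j| + |incrMidCov H k k|))) ≤
      12 * N + s ^ 2 * (5 * ((N : ℝ) ^ (2 * H)) ^ 2 + 2 * (N * (N : ℝ) ^ (2 * H))) := by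
  set K : ℝ := (N : ℝ) ^ (2 * H) with hK
  have hK0 : 0 ≤ K := by positivity
  have hb : ∀ j k, |incrMidCov H j k| ≤ 1 := abs_incrMidCov_le h0 h1
  have step : ∀ j ∈ Finset.range N, ∀ k ∈ Finset.range N,
      (|incrIncrCov H j k| * (1 + s * (|incrMidCov H j j| + |incrMidCov H j k|)) +
        s ^ 2 * ((|incrMidCov H j j| + |incrMidCov H j k|) *
          (|incrMidCov H k j| + |incrMidCov H k k|))) ≤
      3 * |incrIncrCov H j k| + s ^ 2 * (|incrMidCov H j j| * |incrMidCov H k j| +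
        |incrMidCov H j j| * |incrMidCov H k k| + |incrMidCov H j k| * |incrMidCov H k k| +
        |incrMidCov H j k|) := by
    intro j _ k _
    have e1 : s * (|incrMidCov H j j| + |incrMidCov H j k|) ≤ 1 * (1 + 1) :=
      mul_le_mul hs1 (add_le_add (hb j j) (hb j k)) (by positivity) zero_le_one
    have e2 : |incrIncrCov H j k| * (1 + s * (|incrMidCov H j j| + |incrMidCov H j k|)) ≤
        |incrIncrCov H j k| * 3 := by
      gcongr; linarith
    have e3 : |incrMidCov H j k| * |incrMidCov H k j| ≤ |incrMidCov H j k| * 1 := by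
      gcongr; exact hb k j
    have e4 : s ^ 2 * ((|incrMidCov H j j| + |incrMidCov H j k|) *
          (|incrMidCov H k j| + |incrMidCov H k k|)) ≤
        s ^ 2 * (|incrMidCov H j j| * |incrMidCov H k j| +
        |incrMidCov H j j| * |incrMidCov H k k| + |incrMidCov H j k| * |incrMidCov H k k| +
        |incrMidCov H j k|) := by
      gcongr; linarith
    linarith
  refine (Finset.sum_le_sum fun j hj => Finset.sum_le_sum (step j hj)).trans ?_
  simp only [Finset.sum_add_distrib, ← Finset.mul_sum]
  have d := sum_abs_incrMidCov_self_le h0 N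
  have d0 : 0 ≤ ∑ j ∈ Finset.range N, |incrMidCov H j j| :=
    Finset.sum_nonneg fun _ _ => abs_nonneg _
  have c1 : ∑ j ∈ Finset.range N, ∑ k ∈ Finset.range N, |incrIncrCov H j k| ≤ N * 4 := by
    refine (Finset.sum_le_sum fun j _ => sum_abs_incrIncrCov_le h0 h1 j N).trans ?_
    simp
  have c2 : ∑ j ∈ Finset.range N, |incrMidCov H j j| * ∑ k ∈ Finset.range N, |incrMidCov H k j|
      ≤ K * (2 * K) := by
    calc _ ≤ ∑ j ∈ Finset.range N, |incrMidCov H j j| * (2 * K) := by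
          refine Finset.sum_le_sum fun j hj => ?_
          gcongr
          exact sum_abs_incrMidCov_le h0 (Finset.mem_range.1 hj)
      _ ≤ _ := by rw [← Finset.sum_mul]; gcongr
  have c3 : ∑ j ∈ Finset.range N, |incrMidCov H j j| * ∑ k ∈ Finset.range N, |incrMidCov H k k|
      ≤ K * K := by
    rw [← Finset.sum_mul]
    gcongr
  have c4 : ∑ j ∈ Finset.range N, ∑ k ∈ Finset.range N, |incrMidCov H j k| * |incrMidCov H k k|
      ≤ 2 * K * K := by
    rw [Finset.sum_comm]
    simp only [← Finset.sum_mul]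
    calc _ ≤ ∑ k ∈ Finset.range N, 2 * K * |incrMidCov H k k| := by
          refine Finset.sum_le_sum fun k hk => ?_
          gcongr
          exact sum_abs_incrMidCov_le h0 (Finset.mem_range.1 hk)
      _ ≤ _ := by rw [← Finset.mul_sum]; gcongr
  have c5 : ∑ j ∈ Finset.range N, ∑ k ∈ Finset.range N, |incrMidCov H j k| ≤ N * (2 * K) := by
    rw [Finset.sum_comm]
    refine (Finset.sum_le_sum fun k hk =>
      sum_abs_incrMidCov_le h0 (Finset.mem_range.1 hk)).trans ?_
    simp [hK]
  exact add_le_add (by linarith) (mul_le_mul_of_nonneg_left (by linarith) (sq_nonneg s))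

lemma covH_comm (H t s : ℝ) : covH H t s = covH H s t := by
  unfold covH; rw [abs_sub_comm t s]; ring

lemma covH_self {H : ℝ} (h0 : 0 < H) (t : ℝ) : covH H t t = |t| ^ (2 * H) := by
  unfold covH; simp [h0.ne']

lemma covH_mul (H : ℝ) {δ : ℝ} (hδ : 0 ≤ δ) (t s : ℝ) :
    covH H (t * δ) (s * δ) = δ ^ (2 * H) * covH H t s := by
  unfold covH
  rw [← sub_mul, abs_mul, abs_mul, abs_mul, abs_of_nonneg hδ,
    Real.mul_rpow (abs_nonneg _) hδ, Real.mul_rpow (abs_nonneg _) hδ,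
    Real.mul_rpow (abs_nonneg _) hδ]
  ring

namespace IsCenteredGaussianProcess

variable {Ω : Type*} [MeasurableSpace Ω] {P : Measure Ω} {X : ℝ → Ω → ℝ}

lemma hasGaussianLaw {C : ℝ → ℝ → ℝ} (hX : IsCenteredGaussianProcess P X C) {m : ℕ}
    (ts : Fin m → ℝ) : HasGaussianLaw (fun ω i => X (ts i) ω) P := by
  have hm : Measurable (fun ω i => X (ts i) ω) := measurable_pi_lambda _ fun i => hX.1 _
  refine ⟨isGaussian_of_map_eq_gaussianReal fun L => ⟨0, Real.toNNReal
    (∑ i, ∑ j, L (Pi.single i 1) * L (Pi.single j 1) * C (ts i) (ts j)), ?_⟩⟩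
  rw [Measure.map_map L.continuous.measurable hm, ← hX.2 m ts (fun i => L (Pi.single i 1))]
  congr 1
  ext ω
  simp only [Function.comp_apply]
  conv_lhs => rw [← Finset.univ_sum_single (fun i => X (ts i) ω)]
  rw [map_sum]
  refine Finset.sum_congr rfl fun i _ => ?_
  rw [mul_comm, ← smul_eq_mul, ← map_smul]
  congr 1
  rw [← Pi.single_smul, smul_eq_mul, mul_one]

lemma hasAllMoments {C : ℝ → ℝ → ℝ} (hX : IsCenteredGaussianProcess P X C) (t : ℝ) :
    HasAllMoments (X t) P :=
  ((hX.hasGaussianLaw (fun _ : Fin 1 => t)).eval 0).hasAllMoments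

variable {H : ℝ}

lemma map_const_mul_sub (hX : IsCenteredGaussianProcess P X (covH H)) (h0 : 0 < H) (a b c : ℝ) :
    P.map (fun ω => c * (X b ω - X a ω)) =
      gaussianReal 0 (Real.toNNReal (c ^ 2 * |b - a| ^ (2 * H))) := by
  have := hX.2 2 ![b, a] ![c, -c]
  simp only [Fin.sum_univ_two, Matrix.cons_val_zero, Matrix.cons_val_one] at this
  rw [covH_self h0, covH_self h0] at this
  convert this using 2
  · ext ω; ring
  · congr 1
    rw [covH_comm H a b]
    unfold covH
    ring

lemma map_eval (hX : IsCenteredGaussianProcess P X (covH H)) (h0 : 0 < H) (t : ℝ) :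
    P.map (X t) = gaussianReal 0 (Real.toNNReal (|t| ^ (2 * H))) := by
  have := hX.2 1 ![t] ![1]
  simpa [covH_self h0] using this

lemma variance_eval [IsProbabilityMeasure P] (hX : IsCenteredGaussianProcess P X (covH H))
    (h0 : 0 < H) (t : ℝ) : Var[X t; P] = |t| ^ (2 * H) := by
  have h : Var[id; P.map (X t)] = |t| ^ (2 * H) := by
    rw [hX.map_eval h0, variance_id_gaussianReal, Real.coe_toNNReal _ (by positivity)]
  rwa [variance_map aemeasurable_id (hX.1 t).aemeasurable] at h

lemma variance_sub [IsProbabilityMeasure P] (hX : IsCenteredGaussianProcess P X (covH H))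
    (h0 : 0 < H) (a b : ℝ) : Var[fun ω => X b ω - X a ω; P] = |b - a| ^ (2 * H) := by
  have e := hX.map_const_mul_sub h0 a b 1
  simp only [one_mul, one_pow] at e
  have h : Var[id; P.map (fun ω => X b ω - X a ω)] = |b - a| ^ (2 * H) := by
    rw [e, variance_id_gaussianReal, Real.coe_toNNReal _ (by positivity)]
  have hm : AEMeasurable (fun ω => X b ω - X a ω) P := ((hX.1 b).sub (hX.1 a)).aemeasurable
  rwa [variance_map aemeasurable_id hm] at h

lemma covariance_eval [IsProbabilityMeasure P] (hX : IsCenteredGaussianProcess P X (covH H))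
    (h0 : 0 < H) (a b : ℝ) : cov[X a, X b; P] = covH H a b := by
  have h := variance_fun_sub (hX.hasAllMoments a 2) (hX.hasAllMoments b 2)
  rw [hX.variance_sub h0, hX.variance_eval h0, hX.variance_eval h0] at h
  unfold covH
  linarith

end IsCenteredGaussianProcess

/-- The mesh `2^{-n/2}` of the `n`-th dyadic grid. -/
def mesh (n : ℕ) : ℝ := (2 : ℝ) ^ (-(n : ℝ) / 2)

lemma mesh_pos (n : ℕ) : 0 < mesh n := Real.rpow_pos_of_pos two_pos _

lemma mesh_le_one (n : ℕ) : mesh n ≤ 1 :=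
  Real.rpow_le_one_of_one_le_of_nonpos one_le_two (by
    have : (0 : ℝ) ≤ n := n.cast_nonneg
    linarith)

lemma dyadicPt_eq (n j : ℕ) : dyadicPt n j = j * mesh n := rfl

/-- The average of `X` over the end points of the `j`-th dyadic interval. -/
def Xavg (X : ℝ → Ω → ℝ) (n j : ℕ) (ω : Ω) : ℝ :=
  (X (dyadicPt n (j + 1)) ω + X (dyadicPt n j) ω) / 2

/-- The dyadic increment of `X`, rescaled by `2^{nH/2}`. -/
def Xstd (H : ℝ) (X : ℝ → Ω → ℝ) (n j : ℕ) (ω : Ω) : ℝ :=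
  (mesh n ^ H)⁻¹ * Xincr X n j ω

lemma Xincr_eq_mul_Xstd (H : ℝ) (X : ℝ → Ω → ℝ) (n j : ℕ) (ω : Ω) :
    Xincr X n j ω = mesh n ^ H * Xstd H X n j ω := by
  rw [Xstd, mul_inv_cancel_left₀ (Real.rpow_pos_of_pos (mesh_pos n) H).ne']

namespace IsCenteredGaussianProcess

variable {Ω : Type*} [MeasurableSpace Ω] {P : Measure Ω} {X : ℝ → Ω → ℝ} {H : ℝ}

lemma measurable_Xavg {C : ℝ → ℝ → ℝ} (hX : IsCenteredGaussianProcess P X C) (n j : ℕ) :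
    Measurable (Xavg X n j) :=
  ((hX.1 _).add (hX.1 _)).div_const 2

lemma measurable_Xincr {C : ℝ → ℝ → ℝ} (hX : IsCenteredGaussianProcess P X C) (n j : ℕ) :
    Measurable (Xincr X n j) :=
  (hX.1 _).sub (hX.1 _)

lemma measurable_Xstd {C : ℝ → ℝ → ℝ} (hX : IsCenteredGaussianProcess P X C) (n j : ℕ) :
    Measurable (Xstd H X n j) :=
  (hX.measurable_Xincr n j).const_mul _

lemma map_Xstd (hX : IsCenteredGaussianProcess P X (covH H)) (h0 : 0 < H) (n j : ℕ) :
    P.map (Xstd H X n j) = gaussianReal 0 1 := by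
  have h := hX.map_const_mul_sub h0 (dyadicPt n j) (dyadicPt n (j + 1)) (mesh n ^ H)⁻¹
  have hm := mesh_pos n
  have e : (mesh n ^ H)⁻¹ ^ 2 * |dyadicPt n (j + 1) - dyadicPt n j| ^ (2 * H) = 1 := by
    rw [dyadicPt_eq, dyadicPt_eq, ← sub_mul]
    push_cast
    rw [add_sub_cancel_left, one_mul, abs_of_pos hm, mul_comm 2 H, Real.rpow_mul hm.le,
      Real.rpow_two, inv_pow, inv_mul_cancel₀ (by positivity)]
  rw [e, Real.toNNReal_one] at h
  exact h

lemma hasGaussianLaw_Xavg_Xstd {C : ℝ → ℝ → ℝ} (hX : IsCenteredGaussianProcess P X C)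
    (n j k : ℕ) :
    HasGaussianLaw (fun ω i => ![Xavg X n j, Xavg X n k, Xstd H X n j, Xstd H X n k] i ω) P := by
  have hG := hX.hasGaussianLaw
    ![dyadicPt n j, dyadicPt n (j + 1), dyadicPt n k, dyadicPt n (k + 1)]
  let π : Fin 4 → (Fin 4 → ℝ) →L[ℝ] ℝ := fun i => ContinuousLinearMap.proj i
  let L : (Fin 4 → ℝ) →L[ℝ] (Fin 4 → ℝ) := ContinuousLinearMap.pi
    ![(2⁻¹ : ℝ) • (π 1 + π 0), (2⁻¹ : ℝ) • (π 3 + π 2), (mesh n ^ H)⁻¹ • (π 1 - π 0),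
      (mesh n ^ H)⁻¹ • (π 3 - π 2)]
  have e : (fun ω i => ![Xavg X n j, Xavg X n k, Xstd H X n j, Xstd H X n k] i ω) = fun ω =>
      L fun i => X (![dyadicPt n j, dyadicPt n (j + 1), dyadicPt n k, dyadicPt n (k + 1)] i) ω := by
    funext ω i
    fin_cases i <;> simp [L, π, Xavg, Xstd, Xincr] <;> ring
  rw [e]
  exact hG.map_fun L

lemma hasAllMoments_Xincr (hX : IsCenteredGaussianProcess P X (covH H)) (n j : ℕ) :
    HasAllMoments (Xincr X n j) P := fun r => (hX.hasAllMoments _ r).sub (hX.hasAllMoments _ r)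

variable [IsProbabilityMeasure P]

lemma covariance_dyadicPt (hX : IsCenteredGaussianProcess P X (covH H)) (h0 : 0 < H)
    (n j k : ℕ) : cov[X (dyadicPt n j), X (dyadicPt n k); P] = (mesh n ^ H) ^ 2 * covH H j k := by
  rw [hX.covariance_eval h0, dyadicPt_eq, dyadicPt_eq, covH_mul H (mesh_pos n).le, mul_comm 2 H,
    Real.rpow_mul (mesh_pos n).le, Real.rpow_two]

lemma covariance_Xincr_dyadicPt (hX : IsCenteredGaussianProcess P X (covH H)) (h0 : 0 < H)
    (n j k : ℕ) : cov[Xincr X n j, X (dyadicPt n k); P] = (mesh n ^ H) ^ 2 * incrCov H j k := by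
  have h := covariance_fun_sub_left (hX.hasAllMoments (dyadicPt n (j + 1)) 2)
    (hX.hasAllMoments (dyadicPt n j) 2) (hX.hasAllMoments (dyadicPt n k) 2)
  rw [hX.covariance_dyadicPt h0, hX.covariance_dyadicPt h0, ← mul_sub] at h
  rw [incrCov, ← Nat.cast_succ]
  exact h

lemma hasAllMoments_Xstd (hX : IsCenteredGaussianProcess P X (covH H)) (n j : ℕ) :
    HasAllMoments (Xstd H X n j) P := (HasAllMoments.const _).mul (hX.hasAllMoments_Xincr n j)

lemma covariance_Xstd_Xavg (hX : IsCenteredGaussianProcess P X (covH H)) (h0 : 0 < H)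
    (n j k : ℕ) : cov[Xstd H X n j, Xavg X n k; P] = mesh n ^ H * incrMidCov H j k := by
  have hs : mesh n ^ H ≠ 0 := (Real.rpow_pos_of_pos (mesh_pos n) H).ne'
  have h := covariance_add_right (hX.hasAllMoments_Xincr n j 2)
    (hX.hasAllMoments (dyadicPt n (k + 1)) 2) (hX.hasAllMoments (dyadicPt n k) 2)
  rw [hX.covariance_Xincr_dyadicPt h0, hX.covariance_Xincr_dyadicPt h0] at h
  unfold Xstd Xavg
  rw [covariance_const_mul_left, covariance_fun_div_right]
  change _ * (cov[Xincr X n j, X (dyadicPt n (k + 1)) + X (dyadicPt n k); P] / 2) = _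
  rw [h, incrMidCov]
  field_simp
  ring

lemma covariance_Xstd_Xstd (hX : IsCenteredGaussianProcess P X (covH H)) (h0 : 0 < H)
    (n j k : ℕ) : cov[Xstd H X n j, Xstd H X n k; P] = incrIncrCov H j k := by
  have hs : mesh n ^ H ≠ 0 := (Real.rpow_pos_of_pos (mesh_pos n) H).ne'
  have h := covariance_fun_sub_right (hX.hasAllMoments_Xincr n j 2)
    (hX.hasAllMoments (dyadicPt n (k + 1)) 2) (hX.hasAllMoments (dyadicPt n k) 2)
  rw [hX.covariance_Xincr_dyadicPt h0, hX.covariance_Xincr_dyadicPt h0] at h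
  unfold Xstd
  rw [covariance_const_mul_left, covariance_const_mul_right]
  change _ * (_ * cov[Xincr X n j, fun ω => X (dyadicPt n (k + 1)) ω - X (dyadicPt n k) ω; P]) = _
  rw [h, incrIncrCov]
  field_simp

end IsCenteredGaussianProcess

namespace CbSmooth

variable {E : Type*} [NormedAddCommGroup E] [NormedSpace ℝ E] {g : E → ℝ}

lemma exists_abs_le (hg : CbSmooth g) : ∃ M, ∀ x, |g x| ≤ M := by
  obtain ⟨M, hM⟩ := hg.2 0
  exact ⟨M, fun x => by simpa using hM x⟩

lemma hasFDerivAt (hg : CbSmooth g) (x : E) : HasFDerivAt g (fderiv ℝ g x) x :=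
  ((hg.1 1).differentiable (by norm_num) x).hasFDerivAt

lemma fderiv_apply (hg : CbSmooth g) (v : E) : CbSmooth fun x => fderiv ℝ g x v := by
  have hd : ∀ n : ℕ, ContDiff ℝ n (fderiv ℝ g) := fun n =>
    (hg.1 (n + 1)).fderiv_right (by norm_cast)
  refine ⟨fun n => (hd n).clm_apply contDiff_const, fun k => ?_⟩
  obtain ⟨M, hM⟩ := hg.2 (k + 1)
  refine ⟨‖v‖ * M, fun x => ?_⟩
  refine (norm_iteratedFDeriv_clm_apply_const (hd k).contDiffAt le_rfl).trans ?_
  rw [norm_iteratedFDeriv_fderiv]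
  exact mul_le_mul_of_nonneg_left (hM x) (norm_nonneg v)

end CbSmooth

namespace CbSmooth2

variable {f : ℝ → ℝ → ℝ}

lemma continuous (hf : CbSmooth2 f) : Continuous fun p : ℝ × ℝ => f p.1 p.2 :=
  (CbSmooth.hasFDerivAt hf · |>.continuousAt) |> continuous_iff_continuousAt.2

lemma exists_bound_partial_derivs (hf : CbSmooth2 f) :
    ∃ (f₁ f₂ : ℝ → ℝ → ℝ) (M : ℝ), (∀ x y, HasDerivAt (fun u => f u y) (f₁ x y) x) ∧
      (∀ x y, HasDerivAt (fun u => f₁ u y) (f₂ x y) x) ∧ (∀ x y, |f x y| ≤ M) ∧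
      (∀ x y, |f₁ x y| ≤ M) ∧ ∀ x y, |f₂ x y| ≤ M := by
  have hline : ∀ g : ℝ × ℝ → ℝ, CbSmooth g → ∀ x y,
      HasDerivAt (fun u => g (u, y)) (fderiv ℝ g (x, y) (1, 0)) x := fun g hg x y =>
    (hg.hasFDerivAt (x, y)).comp_hasDerivAt x
      ((hasDerivAt_id x).prodMk (hasDerivAt_const x y))
  have hf' : CbSmooth fun p : ℝ × ℝ => f p.1 p.2 := hf
  have hf₁ := hf'.fderiv_apply (1, 0)
  have hf₂ := hf₁.fderiv_apply (1, 0)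
  obtain ⟨M₀, h₀⟩ := hf'.exists_abs_le
  obtain ⟨M₁, h₁⟩ := hf₁.exists_abs_le
  obtain ⟨M₂, h₂⟩ := hf₂.exists_abs_le
  exact ⟨_, _, max M₀ (max M₁ M₂), fun x y => hline _ hf' x y, fun x y => hline _ hf₁ x y,
    fun x y => (h₀ (x, y)).trans (le_max_left _ _),
    fun x y => (h₁ (x, y)).trans (le_max_of_le_right (le_max_left _ _)),
    fun x y => (h₂ (x, y)).trans (le_max_of_le_right (le_max_right _ _))⟩

lemma swap (hf : CbSmooth2 f) : CbSmooth2 fun x y => f y x := by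
  let e : (ℝ × ℝ) ≃ₗᵢ[ℝ] ℝ × ℝ :=
    { LinearEquiv.prodComm ℝ ℝ ℝ with
      norm_map' := fun x => max_comm _ _ }
  refine ⟨fun n => (hf.1 n).comp e.contDiff, fun k => ?_⟩
  obtain ⟨M, hM⟩ := hf.2 k
  exact ⟨M, fun x => (e.norm_iteratedFDeriv_comp_right (fun p => f p.1 p.2) x k).trans_le (hM _)⟩

end CbSmooth2

lemma measurable_iSup_comap {ι Ω : Type*} (X : ι → Ω → ℝ) {κ : Type*} (ts : κ → ι) :
    Measurable[⨆ t, MeasurableSpace.comap (X t) inferInstance] fun ω i => X (ts i) ω :=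
  @measurable_pi_lambda _ _ _ (⨆ t, MeasurableSpace.comap (X t) inferInstance) _ _ fun i =>
    Measurable.of_comap_le (le_iSup (fun t => MeasurableSpace.comap (X t) inferInstance) (ts i))

lemma IndepProcesses.indepFun {Ω : Type*} [MeasurableSpace Ω] {P : Measure Ω} {X1 X2 : ℝ → Ω → ℝ}
    (h : IndepProcesses P X1 X2) {κ κ' : Type*} (ts : κ → ℝ) (us : κ' → ℝ) :
    IndepFun (fun ω i => X1 (ts i) ω) (fun ω i => X2 (us i) ω) P :=
  (IndepFun_iff_Indep _ _ _).2 <| indep_of_indep_of_le h (measurable_iSup_comap X1 ts).comap_le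
    (measurable_iSup_comap X2 us).comap_le

/-- Conditioning on one of two independent random elements: an integral is bounded by integrating a
bound for the integrals over the other one. -/
lemma ProbabilityTheory.IndepFun.abs_integral_le {Ω E E' : Type*} [MeasurableSpace Ω]
    [MeasurableSpace E] [MeasurableSpace E'] {P : Measure Ω} [IsProbabilityMeasure P]
    {V : Ω → E} {W : Ω → E'} (h : IndepFun V W P) (hV : Measurable V) (hW : Measurable W)
    {Φ : E × E' → ℝ} (hΦ : Measurable Φ) (hInteg : Integrable (fun ω => Φ (V ω, W ω)) P)
    {g : E' → ℝ} (hg : Measurable g) (hgint : Integrable (fun ω => g (W ω)) P)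
    (hb : ∀ y, |∫ ω, Φ (V ω, y) ∂P| ≤ g y) :
    |∫ ω, Φ (V ω, W ω) ∂P| ≤ ∫ ω, g (W ω) ∂P := by
  have hVW : Measurable fun ω => (V ω, W ω) := hV.prodMk hW
  have hmap := (indepFun_iff_map_prod_eq_prod_map_map hV.aemeasurable hW.aemeasurable).1 h
  have : IsProbabilityMeasure (P.map V) := Measure.isProbabilityMeasure_map hV.aemeasurable
  have : IsProbabilityMeasure (P.map W) := Measure.isProbabilityMeasure_map hW.aemeasurable
  have hInteg' : Integrable Φ ((P.map V).prod (P.map W)) := by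
    rw [← hmap]
    exact (integrable_map_measure hΦ.aestronglyMeasurable hVW.aemeasurable).2 hInteg
  have e : ∫ ω, Φ (V ω, W ω) ∂P = ∫ y, ∫ ω, Φ (V ω, y) ∂P ∂(P.map W) := by
    rw [← integral_map hVW.aemeasurable hΦ.aestronglyMeasurable, hmap, integral_prod_symm _ hInteg']
    refine integral_congr_ae (ae_of_all _ fun y => ?_)
    exact integral_map hV.aemeasurable
      (hΦ.comp (measurable_id.prodMk measurable_const)).aestronglyMeasurable
  rw [e, ← integral_map hW.aemeasurable hg.aestronglyMeasurable, ← Real.norm_eq_abs]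
  exact norm_integral_le_of_norm_le
    ((integrable_map_measure hg.aestronglyMeasurable hW.aemeasurable).2 hgint)
    (ae_of_all _ hb)

/-- The averages and the rescaled increments over the `j`-th and the `k`-th dyadic intervals. -/
def avgStdVec (H : ℝ) (X : ℝ → Ω → ℝ) (n j k : ℕ) (ω : Ω) : ℝ × ℝ × ℝ × ℝ :=
  (Xavg X n j ω, Xavg X n k ω, Xstd H X n k ω, Xstd H X n j ω)

lemma IndepProcesses.indepFun_avgStdVec {Ω : Type*} [MeasurableSpace Ω] {P : Measure Ω}
    {X1 X2 : ℝ → Ω → ℝ} (h : IndepProcesses P X1 X2) (H : ℝ) (n j k : ℕ) :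
    IndepFun (avgStdVec H X1 n j k) (avgStdVec H X2 n j k) P := by
  let φ : (Fin 4 → ℝ) → ℝ × ℝ × ℝ × ℝ := fun v =>
    ((v 1 + v 0) / 2, (v 3 + v 2) / 2, (mesh n ^ H)⁻¹ * (v 3 - v 2), (mesh n ^ H)⁻¹ * (v 1 - v 0))
  have hφ : Measurable φ := by fun_prop
  let ts := ![dyadicPt n j, dyadicPt n (j + 1), dyadicPt n k, dyadicPt n (k + 1)]
  exact (h.indepFun ts ts).comp hφ hφ

/-- The absolute mixed moments of order `(q, q)` of two standard Gaussian variables are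
bounded by the moment of order `2 q`. -/
lemma integral_abs_pow_mul_pow_le {Ω : Type*} [MeasurableSpace Ω] {P : Measure Ω}
    [IsProbabilityMeasure P] {U V : Ω → ℝ} (hU : HasAllMoments U P) (hV : HasAllMoments V P)
    (hUm : Measurable U) (hVm : Measurable V)
    (hUl : P.map U = gaussianReal 0 1) (hVl : P.map V = gaussianReal 0 1) (q : ℕ) :
    ∫ ω, |U ω ^ q * V ω ^ q| ∂P ≤ ∫ x, (x ^ q) ^ 2 ∂(gaussianReal 0 1) := by
  have hm : ∀ {Y : Ω → ℝ}, Measurable Y → P.map Y = gaussianReal 0 1 →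
      ∫ ω, (Y ω ^ q) ^ 2 ∂P = ∫ x, (x ^ q) ^ 2 ∂(gaussianReal 0 1) := fun {Y} hY hl => by
    rw [← hl, integral_map hY.aemeasurable (by fun_prop)]
  have hiU := ((hU.pow q).pow 2).integrable
  have hiV := ((hV.pow q).pow 2).integrable
  calc ∫ ω, |U ω ^ q * V ω ^ q| ∂P ≤ ∫ ω, ((U ω ^ q) ^ 2 + (V ω ^ q) ^ 2) / 2 ∂P := by
        refine integral_mono ((hU.pow q).mul (hV.pow q)).abs.integrable
          ((hiU.add hiV).div_const 2) fun ω => ?_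
        rw [abs_mul]
        have h := two_mul_le_add_sq |U ω ^ q| |V ω ^ q|
        rw [sq_abs, sq_abs] at h
        linarith
    _ = ∫ x, (x ^ q) ^ 2 ∂(gaussianReal 0 1) := by
        rw [integral_div, integral_add hiU hiV, hm hUm hUl, hm hVm hVl]
        ring

section

variable {Ω : Type*} [MeasurableSpace Ω] {P : Measure Ω}
  {H : ℝ} {X1 X2 : ℝ → Ω → ℝ} {f : ℝ → ℝ → ℝ}

lemma measurable_Xmid (hX1 : IsCenteredGaussianProcess P X1 (covH H))
    (hX2 : IsCenteredGaussianProcess P X2 (covH H)) (hf : CbSmooth2 f) (n j : ℕ) :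
    Measurable (Xmid X1 X2 f n j) :=
  hf.continuous.measurable.comp ((hX1.measurable_Xavg n j).prodMk (hX2.measurable_Xavg n j))

variable [IsProbabilityMeasure P]

lemma hasAllMoments_term (hX1 : IsCenteredGaussianProcess P X1 (covH H))
    (hX2 : IsCenteredGaussianProcess P X2 (covH H)) (hf : CbSmooth2 f) (p q n j : ℕ) :
    HasAllMoments (fun ω => Xmid X1 X2 f n j ω * Xincr X1 n j ω ^ p * Xincr X2 n j ω ^ q) P := by
  obtain ⟨M, hM⟩ := CbSmooth.exists_abs_le hf
  exact ((HasAllMoments.of_bound (measurable_Xmid hX1 hX2 hf n j)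
    fun ω => hM (Xavg X1 n j ω, Xavg X2 n j ω)).mul ((hX1.hasAllMoments_Xincr n j).pow p)).mul
      ((hX2.hasAllMoments_Xincr n j).pow q)

lemma exists_abs_integral_term_mul_term_le (h0 : 0 < H)
    (hX1 : IsCenteredGaussianProcess P X1 (covH H))
    (hX2 : IsCenteredGaussianProcess P X2 (covH H)) (hInd : IndepProcesses P X1 X2)
    (hf : CbSmooth2 f) {p : ℕ} (hp : Odd p) (q : ℕ) :
    ∃ C : ℝ, 0 ≤ C ∧ ∀ n j k : ℕ,
      |∫ ω, (Xmid X1 X2 f n j ω * Xincr X1 n j ω ^ p * Xincr X2 n j ω ^ q) *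
        (Xmid X1 X2 f n k ω * Xincr X1 n k ω ^ p * Xincr X2 n k ω ^ q) ∂P| ≤
      C * ((mesh n ^ H) ^ (p + q)) ^ 2 *
        (|incrIncrCov H j k| * (1 + mesh n ^ H * (|incrMidCov H j j| + |incrMidCov H j k|)) +
          (mesh n ^ H) ^ 2 * ((|incrMidCov H j j| + |incrMidCov H j k|) *
            (|incrMidCov H k j| + |incrMidCov H k k|))) := by
  obtain ⟨C, hC, hbound⟩ := exists_abs_integral_mul_pow_le P hp
  obtain ⟨f₁, f₂, M, hd₁, hd₂, hM, hM₁, hM₂⟩ := hf.exists_bound_partial_derivs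
  set K : ℝ := ∫ x, (x ^ q) ^ 2 ∂(gaussianReal 0 1) with hK
  have hK0 : 0 ≤ K := integral_nonneg fun x => sq_nonneg _
  refine ⟨C * M ^ 2 * K, by positivity, fun n j k => ?_⟩
  set s : ℝ := mesh n ^ H with hs
  have hs0 : 0 ≤ s := Real.rpow_nonneg (mesh_pos n).le H
  set T : ℝ := |incrIncrCov H j k| * (1 + s * (|incrMidCov H j j| + |incrMidCov H j k|)) +
    s ^ 2 * ((|incrMidCov H j j| + |incrMidCov H j k|) *
      (|incrMidCov H k j| + |incrMidCov H k k|)) with hT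
  have hT0 : 0 ≤ T := by positivity
  let Φ : (ℝ × ℝ × ℝ × ℝ) × (ℝ × ℝ × ℝ × ℝ) → ℝ := fun z =>
    f z.1.1 z.2.1 * f z.1.2.1 z.2.2.1 * z.1.2.2.1 ^ p * z.1.2.2.2 ^ p *
      (z.2.2.2.1 ^ q * z.2.2.2.2 ^ q)
  have hfm := hf.continuous.measurable
  have hΦ : Measurable Φ := by
    have e₁ : Measurable fun z : (ℝ × ℝ × ℝ × ℝ) × (ℝ × ℝ × ℝ × ℝ) => f z.1.1 z.2.1 :=
      hfm.comp (by fun_prop : Measurable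
        fun z : (ℝ × ℝ × ℝ × ℝ) × (ℝ × ℝ × ℝ × ℝ) => (z.1.1, z.2.1))
    have e₂ : Measurable fun z : (ℝ × ℝ × ℝ × ℝ) × (ℝ × ℝ × ℝ × ℝ) => f z.1.2.1 z.2.2.1 :=
      hfm.comp (by fun_prop : Measurable
        fun z : (ℝ × ℝ × ℝ × ℝ) × (ℝ × ℝ × ℝ × ℝ) => (z.1.2.1, z.2.2.1))
    fun_prop
  have hVm : ∀ {X : ℝ → Ω → ℝ}, IsCenteredGaussianProcess P X (covH H) →
      Measurable (avgStdVec H X n j k) := fun hX =>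
    (hX.measurable_Xavg n j).prodMk ((hX.measurable_Xavg n k).prodMk
      ((hX.measurable_Xstd n k).prodMk (hX.measurable_Xstd n j)))
  have hmid : ∀ i, HasAllMoments (Xmid X1 X2 f n i) P := fun i =>
    HasAllMoments.of_bound (measurable_Xmid hX1 hX2 hf n i) fun ω =>
      hM (Xavg X1 n i ω) (Xavg X2 n i ω)
  have hInteg : HasAllMoments (fun ω => Φ (avgStdVec H X1 n j k ω, avgStdVec H X2 n j k ω)) P :=
    ((((hmid j).mul (hmid k)).mul ((hX1.hasAllMoments_Xstd n k).pow p)).mul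
      ((hX1.hasAllMoments_Xstd n j).pow p)).mul
        (((hX2.hasAllMoments_Xstd n k).pow q).mul ((hX2.hasAllMoments_Xstd n j).pow q))
  have hmom := ((hX2.hasAllMoments_Xstd (H := H) n k).pow q).mul
    ((hX2.hasAllMoments_Xstd (H := H) n j).pow q)
  have hmain := (hInd.indepFun_avgStdVec H n j k).abs_integral_le (hVm hX1) (hVm hX2) hΦ
    hInteg.integrable (g := fun y => C * M ^ 2 * T * |y.2.2.1 ^ q * y.2.2.2 ^ q|) (by fun_prop)
    (hmom.abs.integrable.const_mul _) ?_
  · have e : ∀ ω, (Xmid X1 X2 f n j ω * Xincr X1 n j ω ^ p * Xincr X2 n j ω ^ q) *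
        (Xmid X1 X2 f n k ω * Xincr X1 n k ω ^ p * Xincr X2 n k ω ^ q) =
        (s ^ (p + q)) ^ 2 * Φ (avgStdVec H X1 n j k ω, avgStdVec H X2 n j k ω) := fun ω => by
      simp only [Xincr_eq_mul_Xstd H, ← hs, Φ, avgStdVec, Xmid, Xavg]
      ring
    simp only [e]
    rw [integral_const_mul, abs_mul, abs_of_nonneg (by positivity : 0 ≤ (s ^ (p + q)) ^ 2)]
    have hK' : ∫ ω, |Xstd H X2 n k ω ^ q * Xstd H X2 n j ω ^ q| ∂P ≤ K :=
      integral_abs_pow_mul_pow_le (hX2.hasAllMoments_Xstd n k) (hX2.hasAllMoments_Xstd n j)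
        (hX2.measurable_Xstd n k) (hX2.measurable_Xstd n j) (hX2.map_Xstd h0 n k)
        (hX2.map_Xstd h0 n j) q
    rw [integral_const_mul] at hmain
    calc _ ≤ (s ^ (p + q)) ^ 2 * (C * M ^ 2 * T * K) :=
          mul_le_mul_of_nonneg_left (hmain.trans
            (mul_le_mul_of_nonneg_left hK' (by positivity))) (by positivity)
      _ = _ := by ring
  · intro y
    simp only [Φ]
    rw [integral_mul_const, abs_mul]
    refine mul_le_mul_of_nonneg_right ?_ (abs_nonneg _)
    refine (hbound _ _ _ _ (hX1.measurable_Xavg n j) (hX1.measurable_Xavg n k)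
      (hX1.measurable_Xstd n j) (hX1.measurable_Xstd n k) (hX1.hasGaussianLaw_Xavg_Xstd n j k)
      (hX1.map_Xstd h0 n j) (hX1.map_Xstd h0 n k) _ _ _ _ _ _ M (fun x => hd₁ x y.1) (fun x => hd₂ x y.1)
      (fun x => hd₁ x y.2.1) (fun x => hd₂ x y.2.1) (fun x => hM x _) (fun x => hM₁ x _)
      (fun x => hM₂ x _) (fun x => hM x _) (fun x => hM₁ x _) (fun x => hM₂ x _)).trans_eq ?_
    simp only [hX1.covariance_Xstd_Xstd h0, hX1.covariance_Xstd_Xavg h0, ← hs, abs_mul,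
        abs_of_nonneg hs0, hT]
    ring

end

lemma nSteps_mul_mesh_le {t : ℝ} (ht : 0 ≤ t) (n : ℕ) : nSteps n t * mesh n ≤ t := by
  have h : (nSteps n t : ℝ) ≤ (2 : ℝ) ^ ((n : ℝ) / 2) * t := Nat.floor_le (by positivity)
  have e : (2 : ℝ) ^ ((n : ℝ) / 2) * mesh n = 1 := by
    rw [mesh, ← Real.rpow_add two_pos, neg_div, add_neg_cancel, Real.rpow_zero]
  calc nSteps n t * mesh n ≤ (2 : ℝ) ^ ((n : ℝ) / 2) * t * mesh n :=
        mul_le_mul_of_nonneg_right h (mesh_pos n).le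
    _ = t := by rw [mul_right_comm, e, one_mul]

lemma tendsto_mesh : Tendsto mesh atTop (nhds 0) := by
  have e : mesh = fun n : ℕ => ((2 : ℝ) ^ (-(1 / 2) : ℝ)) ^ n := by
    funext n
    rw [mesh, ← Real.rpow_natCast, ← Real.rpow_mul two_pos.le]
    congr 1
    ring
  rw [e]
  exact tendsto_pow_atTop_nhds_zero_of_lt_one (by positivity)
    (Real.rpow_lt_one_of_one_lt_of_neg one_lt_two (by norm_num))

/-- The `L²` bound for sums over `N` intervals of length `δ`, when `N δ ≤ t`. -/
lemma rpow_pow_sq_mul_le {H δ t : ℝ} (h0 : 0 < H) (h1 : H < 1 / 2) (hδ : 0 < δ)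
    {N : ℕ} (hN : N * δ ≤ t) (r : ℕ) :
    ((δ ^ H) ^ r) ^ 2 * (12 * N + (δ ^ H) ^ 2 *
      (5 * ((N : ℝ) ^ (2 * H)) ^ 2 + 2 * (N * (N : ℝ) ^ (2 * H)))) ≤
    (12 + 7 * t ^ (2 * H)) * t * δ ^ (2 * H * r - 1) := by
  have hN0 : (0 : ℝ) ≤ N := N.cast_nonneg
  have ht : 0 ≤ t := (by positivity : 0 ≤ N * δ).trans hN
  set K : ℝ := (N : ℝ) ^ (2 * H) with hK
  have hK0 : 0 ≤ K := by positivity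
  have hKN : K ≤ N := by
    rcases Nat.eq_zero_or_pos N with h | h
    · rw [hK, h, Nat.cast_zero, Real.zero_rpow (by positivity)]
    · exact (Real.rpow_le_rpow_of_exponent_le (by exact_mod_cast h) (by linarith)).trans_eq
        (Real.rpow_one _)
  have hs : (δ ^ H) ^ 2 = δ ^ (2 * H) := by
    rw [← Real.rpow_natCast, ← Real.rpow_mul hδ.le, mul_comm H]
    norm_num
  have hsK : (δ ^ H) ^ 2 * K ≤ t ^ (2 * H) := by
    rw [hs, hK, ← Real.mul_rpow hδ.le hN0, mul_comm δ]
    exact Real.rpow_le_rpow (by positivity) hN (by positivity)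
  have hr : ((δ ^ H) ^ r) ^ 2 = δ ^ (2 * H * r - 1) * δ := by
    rw [← pow_mul, mul_comm r, pow_mul, hs, ← Real.rpow_natCast, ← Real.rpow_mul hδ.le,
      ← Real.rpow_add_one hδ.ne', sub_add_cancel]
  have e : (δ ^ H) ^ 2 * (5 * K ^ 2 + 2 * (N * K)) ≤ t ^ (2 * H) * (7 * N) := by
    calc _ = (δ ^ H) ^ 2 * K * (5 * K + 2 * N) := by ring
      _ ≤ t ^ (2 * H) * (7 * N) := mul_le_mul hsK (by linarith) (by positivity) (by positivity)
  calc _ ≤ δ ^ (2 * H * r - 1) * δ * (12 * N + t ^ (2 * H) * (7 * N)) := by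
        rw [hr]
        gcongr
    _ = (12 + 7 * t ^ (2 * H)) * δ ^ (2 * H * r - 1) * (N * δ) := by ring
    _ ≤ (12 + 7 * t ^ (2 * H)) * δ ^ (2 * H * r - 1) * t := by gcongr
    _ = _ := by ring

lemma tendsto_integral_sq_sum_term_of_odd {Ω : Type*} [MeasurableSpace Ω] {P : Measure Ω}
    [IsProbabilityMeasure P] {H : ℝ} (h0 : 0 < H) (h1 : H < 1 / 2) {X1 X2 : ℝ → Ω → ℝ}
    (hX1 : IsCenteredGaussianProcess P X1 (covH H))
    (hX2 : IsCenteredGaussianProcess P X2 (covH H)) (hInd : IndepProcesses P X1 X2)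
    {f : ℝ → ℝ → ℝ} (hf : CbSmooth2 f) {t : ℝ} (ht : 0 ≤ t) {p : ℕ} (hp : Odd p) (q : ℕ)
    (hr : 1 < 2 * H * (p + q : ℕ)) :
    Tendsto (fun n : ℕ => ∫ ω, (∑ j ∈ Finset.range (nSteps n t),
      (Xmid X1 X2 f n j ω * Xincr X1 n j ω ^ p * Xincr X2 n j ω ^ q)) ^ 2 ∂P) atTop (nhds 0) := by
  obtain ⟨C, hC, hbound⟩ := exists_abs_integral_term_mul_term_le h0 hX1 hX2 hInd hf hp q
  have hlim : Tendsto (fun n => C * ((12 + 7 * t ^ (2 * H)) * t *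
      mesh n ^ (2 * H * (p + q : ℕ) - 1))) atTop (nhds 0) := by
    have h := tendsto_mesh.rpow_const (p := 2 * H * (p + q : ℕ) - 1) (Or.inr (by linarith))
    rw [Real.zero_rpow (by linarith)] at h
    simpa using (h.const_mul ((12 + 7 * t ^ (2 * H)) * t)).const_mul C
  refine squeeze_zero (fun n => integral_nonneg fun ω => sq_nonneg _) (fun n => ?_) hlim
  have hY := hasAllMoments_term hX1 hX2 hf p q n
  simp only [sq, Finset.sum_mul_sum]
  rw [integral_finsetSum _ fun j _ => integrable_finsetSum _ fun k _ =>
    ((hY j).mul (hY k)).integrable]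
  simp only [integral_finsetSum _ fun k _ => ((hY _).mul (hY k)).integrable]
  calc _ ≤ ∑ j ∈ Finset.range (nSteps n t), ∑ k ∈ Finset.range (nSteps n t),
        C * ((mesh n ^ H) ^ (p + q)) ^ 2 *
        (|incrIncrCov H j k| * (1 + mesh n ^ H * (|incrMidCov H j j| + |incrMidCov H j k|)) +
          (mesh n ^ H) ^ 2 * ((|incrMidCov H j j| + |incrMidCov H j k|) *
            (|incrMidCov H k j| + |incrMidCov H k k|))) :=
        Finset.sum_le_sum fun j _ => Finset.sum_le_sum fun k _ =>
          (le_abs_self _).trans (hbound n j k)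
    _ ≤ C * ((mesh n ^ H) ^ (p + q)) ^ 2 * _ := by
        simp only [← Finset.mul_sum]
        exact mul_le_mul_of_nonneg_left (sum_sum_covariance_le h0 h1
          (Real.rpow_le_one (mesh_pos n).le (mesh_le_one n) h0.le) _) (by positivity)
    _ ≤ _ := by
        rw [mul_assoc]
        exact mul_le_mul_of_nonneg_left
          (rpow_pow_sq_mul_le h0 h1 (mesh_pos n) (nSteps_mul_mesh_le ht n) _) hC

theorem weighted_power_variation_L2_to_zero
    {Ω : Type*} [MeasurableSpace Ω] (P : Measure Ω) [IsProbabilityMeasure P]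
    (H : ℝ) (hH1 : (1 : ℝ) / 6 ≤ H) (hH2 : H < 1 / 2)
    (X1 X2 : ℝ → Ω → ℝ)
    (hX1 : IsCenteredGaussianProcess P X1 (covH H))
    (hX2 : IsCenteredGaussianProcess P X2 (covH H))
    (hInd : IndepProcesses P X1 X2)
    (f : ℝ → ℝ → ℝ) (hf : CbSmooth2 f)
    (t : ℝ) (ht : 0 ≤ t)
    (p q : ℕ) (hpq : Odd (p + q))
    (hcase : ((1 : ℝ) / 6 < H ∧ 3 ≤ p + q) ∨ (H = 1 / 6 ∧ 5 ≤ p + q)) :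
    Tendsto
      (fun n : ℕ => ∫ ω,
        (∑ j ∈ Finset.range (nSteps n t),
          (Xmid X1 X2 f n j ω * Xincr X1 n j ω ^ p * Xincr X2 n j ω ^ q)) ^ 2 ∂P)
      atTop (nhds 0) := by
  have h0 : 0 < H := by linarith
  have hr : 1 < 2 * H * (p + q : ℕ) := by
    rcases hcase with ⟨h, h3⟩ | ⟨h, h5⟩
    · have h3' : (3 : ℝ) ≤ (p + q : ℕ) := by exact_mod_cast h3
      nlinarith
    · have h5' : (5 : ℝ) ≤ (p + q : ℕ) := by exact_mod_cast h5
      rw [h]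
      linarith
  rcases Nat.even_or_odd p with hp | hp
  · have hq : Odd q := (Nat.odd_add'.1 hpq).2 hp
    rw [add_comm p q] at hr
    have h := tendsto_integral_sq_sum_term_of_odd h0 hH2 hX2 hX1 hInd.symm hf.swap ht hq p hr
    simpa only [Xmid, mul_right_comm] using h
  · exact tendsto_integral_sq_sum_term_of_odd h0 hH2 hX1 hX2 hInd hf ht hp q hr

end
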